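/- Let G be a nonempty position. Then: (1) if c(G) ≥ 2 and G consists of exactly one 3-chain together with one or more loops (and no other components), then opening a loop of minimal length is optimal; (2) if c(G) ∈ {−1, 0, 1}, G contains a 4-loop, and G is not the position consisting of one 4-loop and three 3-chains, then opening a loop of minimal length is optimal; (3) if c(G) ≤ −2 and G consists of a 4-loop, a 3-chain, and a (possibly empty) collection H of further components such that H contains no 3-chains and size(H) is divisible by 4, then opening a loop of minimal length is optimal. In every case not covered by (1)–(3), the standard move is optimal. -/

import Mathlib

namespace DotsAndBoxes

/-- A component of a Dots & Boxes endgame position: an `n`-chain or an `n`-loop. -/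
inductive Component : Type where
  | chain (n : ℕ)
  | loop (n : ℕ)
deriving DecidableEq

namespace Component

/-- The number of boxes in a component. -/
def size : Component → ℕ
  | chain n => n
  | loop n => n

def isChain : Component → Bool
  | chain _ => true
  | loop _ => false

def isLoop : Component → Bool
  | chain _ => false
  | loop _ => true

/-- A chain must have length at least 3; a loop must have even length at least 4. -/
def Valid : Component → Prop
  | chain n => 3 ≤ n
  | loop n => 4 ≤ n ∧ Even n

end Component

/-- A position is a finite multiset of components. -/
abbrev Position := Multiset Component

def Position.Valid (G : Position) : Prop := ∀ C ∈ G, C.Valid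

/-- The number of unclaimed boxes in a position. -/
def size (G : Position) : ℕ := (G.map Component.size).sum

/-- The number of chains of a position. -/
def numChains (G : Position) : ℕ := Multiset.card (G.filter fun C => C.isChain = true)

/-- The number of loops of a position. -/
def numLoops (G : Position) : ℕ := Multiset.card (G.filter fun C => C.isLoop = true)

/-- θ(G), the number of 3-chains. -/
def theta (G : Position) : ℕ := G.count (Component.chain 3)

/-- f(G), the number of 4-loops. -/
def numF (G : Position) : ℕ := G.count (Component.loop 4)

/-- s(G), the number of 6-loops. -/
def numS (G : Position) : ℕ := G.count (Component.loop 6)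

open Classical in
/-- The terminal bonus tb(G). -/
noncomputable def tb (G : Position) : ℤ :=
  if G = 0 then 0
  else if ∀ C ∈ G, C.isLoop = true then 8
  else if (∃ C ∈ G, C.isLoop = true) ∧ Component.chain 3 ∈ G ∧
      (∀ C ∈ G, C.isChain = true → C = Component.chain 3) then 6
  else 4

/-- The controlled value c(G). -/
noncomputable def cval (G : Position) : ℤ :=
  (size G : ℤ) - 4 * (numChains G : ℤ) - 8 * (numLoops G : ℤ) + tb G

/-- The score v(G;C) of opening component `C`, given that the remainder of the
position has value `w`. -/
def openVal (C : Component) (w : ℤ) : ℤ :=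
  match C with
  | Component.chain n => ((n : ℤ) - 2) + |w - 2|
  | Component.loop n => ((n : ℤ) - 4) + |w - 4|

/-- Auxiliary recursion (on the number of components) for the value `v`. -/
noncomputable def valueAux : ℕ → Position → ℤ
  | 0, _ => 0
  | n + 1, G =>
    if G = 0 then 0
    else sInf { x : ℤ | ∃ C ∈ G, x = openVal C (valueAux n (G.erase C)) }

/-- The value v(G): v(∅) = 0, and v(G) = min over components C of G of v(G;C). -/
noncomputable def value (G : Position) : ℤ := valueAux (Multiset.card G) G

/-- v(G;C), the value of G given that the opener has just opened C. -/
noncomputable def valueOpen (G : Position) (C : Component) : ℤ :=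
  openVal C (value (G.erase C))

/-- Opening a component C of G is optimal if C ∈ G and v(G;C) = v(G). -/
def Optimal (G : Position) (C : Component) : Prop :=
  C ∈ G ∧ valueOpen G C = value G


/-- Case (1) of the opener strategy theorem: c(G) ≥ 2 and G consists of exactly one
3-chain together with one or more loops. -/
def OpenerCase1 (G : Position) : Prop :=
  2 ≤ cval G ∧ ∃ L : Position, L ≠ 0 ∧ (∀ C ∈ L, C.isLoop = true) ∧
    G = Component.chain 3 ::ₘ L

/-- Case (2): c(G) ∈ {−1,0,1}, G contains a 4-loop, and G is not one 4-loop plus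
three 3-chains. -/
def OpenerCase2 (G : Position) : Prop :=
  (cval G = -1 ∨ cval G = 0 ∨ cval G = 1) ∧ Component.loop 4 ∈ G ∧
    G ≠ Component.loop 4 ::ₘ Component.chain 3 ::ₘ Component.chain 3 ::ₘ {Component.chain 3}

/-- Case (3): c(G) ≤ −2 and G consists of a 4-loop, a 3-chain and a collection H
with no 3-chains and size divisible by 4. -/
def OpenerCase3 (G : Position) : Prop :=
  cval G ≤ -2 ∧ ∃ H : Position,
    G = Component.loop 4 ::ₘ Component.chain 3 ::ₘ H ∧ theta H = 0 ∧ 4 ∣ size H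

/-- The standard move: open a 3-chain if G has one; otherwise a loop of minimal length
if G has a loop; otherwise a chain of minimal length. -/
def IsStandardMove (G : Position) (C : Component) : Prop :=
  (C = Component.chain 3 ∧ C ∈ G) ∨
  (theta G = 0 ∧ ∃ n : ℕ, C = Component.loop n ∧ C ∈ G ∧
      ∀ m : ℕ, Component.loop m ∈ G → n ≤ m) ∨
  (theta G = 0 ∧ (∀ C' ∈ G, C'.isLoop = false) ∧ ∃ n : ℕ, C = Component.chain n ∧ C ∈ G ∧
      ∀ m : ℕ, Component.chain m ∈ G → n ≤ m)

/-- Terminal bonus in terms of the numerical invariants. -/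
def tbN (t a f b : ℕ) : ℤ :=
  if t = 0 ∧ a = 0 then (if f = 0 ∧ b = 0 then 0 else 8)
  else if a = 0 ∧ (f ≠ 0 ∨ b ≠ 0) then 6 else 4

/-- Value in terms of the numerical invariants and of the terminal bonus. -/
def FT (t a A f b B : ℕ) (T : ℤ) : ℤ :=
  if t = 0 ∧ a = 0 ∧ f = 0 ∧ b = 0 then 0
  else if 2 ≤ (A : ℤ) + 2 * B - t - 4 * f - 2 * b + T then
    (A : ℤ) + 2 * B - t - 4 * f - 2 * b + T
  else if 1 ≤ f ∧ -1 ≤ (A : ℤ) + 2 * B - t - 4 * f - 2 * b + T then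
    (if t = 2 ∧ a = 0 ∧ f = 1 ∧ b = 0 then 2 else
     if 0 ≤ (A : ℤ) + 2 * B - t - 4 * f - 2 * b + T then
      (A : ℤ) + 2 * B - t - 4 * f - 2 * b + T
     else -((A : ℤ) + 2 * B - t - 4 * f - 2 * b + T))
  else if 2 ≤ t then 2 - ((t : ℤ) + A) % 2
  else if t = 1 then
    (if (3 + A + 2 * b + 2 * B) % 4 ≠ 3 then 2 - (1 + (A : ℤ)) % 2
     else if 2 ≤ (A : ℤ) + 2 * B - t - 2 * b + 4 then
      (if ((A : ℤ) + 2 * B - t - 4 * f - 2 * b + 4) % 8 = 3 then 3 else 1)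
     else if f % 2 = 0 then 3 else 1)
  else if 2 ≤ (A : ℤ) + 2 * B - 2 * b + T then
    min (((A : ℤ) + 2 * B - 4 * f - 2 * b + T) % 8) (8 - ((A : ℤ) + 2 * B - 4 * f - 2 * b + T) % 8)
  else if f % 2 = 0 then
    4 - min (((A : ℤ) + 2 * b + 2 * B) % 4) (4 - ((A : ℤ) + 2 * b + 2 * B) % 4)
  else min (((A : ℤ) + 2 * b + 2 * B) % 4) (4 - ((A : ℤ) + 2 * b + 2 * B) % 4)

/-- The value as a function of the numerical invariants. -/
def FN (t a A f b B : ℕ) : ℤ := FT t a A f b B (tbN t a f b)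

theorem tbN_spec (t a f b : ℕ) :
    (t = 0 ∧ a = 0 ∧ f = 0 ∧ b = 0 ∧ tbN t a f b = 0) ∨
    (t = 0 ∧ a = 0 ∧ 1 ≤ f + b ∧ tbN t a f b = 8) ∨
    (1 ≤ t ∧ a = 0 ∧ 1 ≤ f + b ∧ tbN t a f b = 6) ∨
    (1 ≤ t ∧ a = 0 ∧ f = 0 ∧ b = 0 ∧ tbN t a f b = 4) ∨
    (1 ≤ a ∧ tbN t a f b = 4) := by
  unfold tbN; split_ifs <;> omega

theorem tbN_even (t a f b : ℕ) : tbN t a f b % 2 = 0 := by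
  unfold tbN; split_ifs <;> rfl

/-- The controlled value in terms of the invariants. -/
def CN (t a A f b B : ℕ) : ℤ := (A : ℤ) + 2 * B - t - 4 * f - 2 * b + tbN t a f b

/-- The exceptional cases (1)-(3) in terms of the invariants. -/
def CaseN (t a A f b B : ℕ) : Prop :=
  (2 ≤ CN t a A f b B ∧ t = 1 ∧ a = 0 ∧ 1 ≤ f + b) ∨
  (-1 ≤ CN t a A f b B ∧ CN t a A f b B ≤ 1 ∧ 1 ≤ f ∧ ¬ (f = 1 ∧ t = 3 ∧ a = 0 ∧ b = 0)) ∨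
  (CN t a A f b B ≤ -2 ∧ 1 ≤ f ∧ t = 1 ∧ (A + 2 * b + 2 * B) % 4 = 0)

/-- Case description of `FT`, with `c` the controlled value and `v` the value. -/
def Spec (t a A f b B : ℕ) (T c v : ℤ) : Prop :=
    (2 ≤ c ∧ v = c) ∨
    (1 ≤ f ∧ -1 ≤ c ∧ c ≤ 1 ∧
      ((t = 2 ∧ a = 0 ∧ f = 1 ∧ b = 0 ∧ v = 2) ∨
        (¬ (t = 2 ∧ a = 0 ∧ f = 1 ∧ b = 0) ∧
          ((c = 0 ∧ v = 0) ∨ (c = 1 ∧ v = 1) ∨ (c = -1 ∧ v = 1))))) ∨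
    (c ≤ 1 ∧ (f = 0 ∨ c ≤ -2) ∧
      ((2 ≤ t ∧ ((t + A) % 2 = 0 ∧ v = 2 ∨ (t + A) % 2 = 1 ∧ v = 1)) ∨
       (t = 1 ∧ ((A % 2 = 1 ∧ v = 2) ∨ ((A + 2 * b + 2 * B) % 4 = 2 ∧ v = 1) ∨
          ((A + 2 * b + 2 * B) % 4 = 0 ∧
            ((2 ≤ c - T + 4 * f + 4 ∧ ((c - T) % 8 = 7 ∧ v = 3 ∨
               (c - T) % 8 = 3 ∧ v = 1)) ∨
             (c - T + 4 * f + 4 ≤ 1 ∧ (f % 2 = 0 ∧ v = 3 ∨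
               f % 2 = 1 ∧ v = 1)))))) ∨
       (t = 0 ∧ ((2 ≤ c + 4 * f ∧ (c % 8 = 0 ∧ v = 0 ∨ c % 8 = 1 ∧ v = 1 ∨ c % 8 = 2 ∧ v = 2 ∨
            c % 8 = 3 ∧ v = 3 ∨ c % 8 = 4 ∧ v = 4 ∨ c % 8 = 5 ∧ v = 3 ∨ c % 8 = 6 ∧ v = 2 ∨
            c % 8 = 7 ∧ v = 1)) ∨
          (c + 4 * f ≤ 1 ∧
          ((f % 2 = 0 ∧ ((A + 2 * b + 2 * B) % 4 = 0 ∧ v = 4 ∨ (A + 2 * b + 2 * B) % 4 = 2 ∧ v = 2 ∨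
              A % 2 = 1 ∧ v = 3)) ∨
           (f % 2 = 1 ∧ ((A + 2 * b + 2 * B) % 4 = 0 ∧ v = 0 ∨ (A + 2 * b + 2 * B) % 4 = 2 ∧ v = 2 ∨
              A % 2 = 1 ∧ v = 1))))))))

set_option maxHeartbeats 4000000 in
theorem FT_spec (t a A f b B : ℕ) (T c : ℤ) (hc : c = (A : ℤ) + 2 * B - t - 4 * f - 2 * b + T)
    (hne : 1 ≤ t + a + f + b) (hT : T % 2 = 0) : Spec t a A f b B T c (FT t a A f b B T) := by
  subst hc
  unfold FT Spec
  split_ifs with h1 h2 h3 h4 h5 h6 h7 h8 h9 h10 h11 h12 h13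
  · exfalso; omega
  · left; omega
  · right; left; omega
  · right; left; omega
  · right; left; omega
  all_goals right; right; refine ⟨by omega, by omega, ?_⟩
  · left; omega
  all_goals right
  · left; omega
  · left; refine ⟨by omega, ?_⟩; right; right; refine ⟨by omega, ?_⟩; omega
  · left; refine ⟨by omega, ?_⟩; right; right; refine ⟨by omega, ?_⟩; omega
  · left; refine ⟨by omega, ?_⟩; right; right; refine ⟨by omega, ?_⟩; omega
  · left; refine ⟨by omega, ?_⟩; right; right; refine ⟨by omega, ?_⟩; omega
  all_goals right; refine ⟨by omega, ?_⟩
  · left; refine ⟨by omega, ?_⟩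
    obtain rfl : t = 0 := by omega
    simp only [Nat.cast_zero, sub_zero]
    generalize (A : ℤ) + 2 * B - 4 * f - 2 * b + T = c
    omega
  · right; refine ⟨by omega, ?_⟩; left; refine ⟨by omega, ?_⟩; omega
  · right; refine ⟨by omega, ?_⟩; right; refine ⟨by omega, ?_⟩; omega

set_option maxHeartbeats 0 in
theorem low_c3 (t a A f b B d : ℕ) (hA : a = 0 → A = 0) (hB : b = 0 → B = 0)
    (hne : 1 ≤ t + a + f + b) :
    FN (t + 1) a A f b B ≤ 1 + |FN t a A f b B - 2| := by
  have s1 := FT_spec t a A f b B (tbN t a f b) _ rfl hne (tbN_even _ _ _ _)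
  have s2 := FT_spec (t + 1) a A f b B (tbN (t + 1) a f b) _ rfl (by omega) (tbN_even _ _ _ _)
  simp only [FN]
  generalize FT t a A f b B (tbN t a f b) = v at *
  generalize FT (t + 1) a A f b B (tbN (t + 1) a f b) = v' at *
  rcases tbN_spec t a f b with h | h | h | h | h <;>
  rcases tbN_spec (t + 1) a f b with h' | h' | h' | h' | h' <;>
  first | (exfalso; omega) | skip
  all_goals
    generalize tbN t a f b = T at *
    generalize tbN (t + 1) a f b = T' at *
    obtain ⟨rfl⟩ : T = _ := by first | exact h.2.2.2.2 | exact h.2.2.2 | exact h.2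
    obtain ⟨rfl⟩ : T' = _ := by first | exact h'.2.2.2.2 | exact h'.2.2.2 | exact h'.2
    unfold Spec at s1 s2
    rcases abs_cases (v - 2) with ⟨e, he⟩ | ⟨e, he⟩ <;> rw [e] <;>
      rcases s1 with s1 | s1 | s1 <;> rcases s2 with s2 | s2 | s2 <;> omega
set_option maxHeartbeats 0 in
theorem low_ch (t a A f b B d : ℕ) (hA : a = 0 → A = 0) (hB : b = 0 → B = 0)
    (hne : 1 ≤ t + a + f + b) :
    FN t (a + 1) (A + d) f b B ≤ ((d : ℤ) + 2) + |FN t a A f b B - 2| := by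
  have s1 := FT_spec t a A f b B (tbN t a f b) _ rfl hne (tbN_even _ _ _ _)
  have s2 := FT_spec t (a + 1) (A + d) f b B (tbN t (a + 1) f b) _ rfl (by omega) (tbN_even _ _ _ _)
  simp only [FN]
  generalize FT t a A f b B (tbN t a f b) = v at *
  generalize FT t (a + 1) (A + d) f b B (tbN t (a + 1) f b) = v' at *
  rcases tbN_spec t a f b with h | h | h | h | h <;>
  rcases tbN_spec t (a + 1) f b with h' | h' | h' | h' | h' <;>
  first | (exfalso; omega) | skip
  all_goals
    generalize tbN t a f b = T at *
    generalize tbN t (a + 1) f b = T' at *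
    obtain ⟨rfl⟩ : T = _ := by first | exact h.2.2.2.2 | exact h.2.2.2 | exact h.2
    obtain ⟨rfl⟩ : T' = _ := by first | exact h'.2.2.2.2 | exact h'.2.2.2 | exact h'.2
    unfold Spec at s1 s2
    rcases abs_cases (v - 2) with ⟨e, he⟩ | ⟨e, he⟩ <;> rw [e] <;>
      rcases s1 with s1 | s1 | s1 <;> rcases s2 with s2 | s2 | s2 <;> omega
set_option maxHeartbeats 0 in
theorem low_l4 (t a A f b B d : ℕ) (hA : a = 0 → A = 0) (hB : b = 0 → B = 0)
    (hne : 1 ≤ t + a + f + b) :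
    FN t a A (f + 1) b B ≤ |FN t a A f b B - 4| := by
  have s1 := FT_spec t a A f b B (tbN t a f b) _ rfl hne (tbN_even _ _ _ _)
  have s2 := FT_spec t a A (f + 1) b B (tbN t a (f + 1) b) _ rfl (by omega) (tbN_even _ _ _ _)
  simp only [FN]
  generalize FT t a A f b B (tbN t a f b) = v at *
  generalize FT t a A (f + 1) b B (tbN t a (f + 1) b) = v' at *
  rcases tbN_spec t a f b with h | h | h | h | h <;>
  rcases tbN_spec t a (f + 1) b with h' | h' | h' | h' | h' <;>
  first | (exfalso; omega) | skip
  all_goals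
    generalize tbN t a f b = T at *
    generalize tbN t a (f + 1) b = T' at *
    obtain ⟨rfl⟩ : T = _ := by first | exact h.2.2.2.2 | exact h.2.2.2 | exact h.2
    obtain ⟨rfl⟩ : T' = _ := by first | exact h'.2.2.2.2 | exact h'.2.2.2 | exact h'.2
    unfold Spec at s1 s2
    rcases abs_cases (v - 4) with ⟨e, he⟩ | ⟨e, he⟩ <;> rw [e] <;>
      rcases s1 with s1 | s1 | s1 <;> rcases s2 with s2 | s2 | s2 <;> omega
set_option maxHeartbeats 0 in
theorem low_lo (t a A f b B d : ℕ) (hA : a = 0 → A = 0) (hB : b = 0 → B = 0)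
    (hne : 1 ≤ t + a + f + b) :
    FN t a A f (b + 1) (B + d) ≤ (2 * (d : ℤ) + 2) + |FN t a A f b B - 4| := by
  have s1 := FT_spec t a A f b B (tbN t a f b) _ rfl hne (tbN_even _ _ _ _)
  have s2 := FT_spec t a A f (b + 1) (B + d) (tbN t a f (b + 1)) _ rfl (by omega) (tbN_even _ _ _ _)
  simp only [FN]
  generalize FT t a A f b B (tbN t a f b) = v at *
  generalize FT t a A f (b + 1) (B + d) (tbN t a f (b + 1)) = v' at *
  rcases tbN_spec t a f b with h | h | h | h | h <;>
  rcases tbN_spec t a f (b + 1) with h' | h' | h' | h' | h' <;>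
  first | (exfalso; omega) | skip
  all_goals
    generalize tbN t a f b = T at *
    generalize tbN t a f (b + 1) = T' at *
    obtain ⟨rfl⟩ : T = _ := by first | exact h.2.2.2.2 | exact h.2.2.2 | exact h.2
    obtain ⟨rfl⟩ : T' = _ := by first | exact h'.2.2.2.2 | exact h'.2.2.2 | exact h'.2
    unfold Spec at s1 s2
    rcases abs_cases (v - 4) with ⟨e, he⟩ | ⟨e, he⟩ <;> rw [e] <;>
      rcases s1 with s1 | s1 | s1 <;> rcases s2 with s2 | s2 | s2 <;> omega

set_option maxHeartbeats 0 in
theorem up_l4 (t a A f b B d : ℕ) (hA : a = 0 → A = 0) (hB : b = 0 → B = 0)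
    (hne : 1 ≤ t + a + f + b)
    (hh : CaseN t a A (f + 1) b B ∨ t = 0) :
    |FN t a A f b B - 4| ≤ FN t a A (f + 1) b B := by
  have s1 := FT_spec t a A f b B (tbN t a f b) _ rfl hne (tbN_even _ _ _ _)
  have s2 := FT_spec t a A (f + 1) b B (tbN t a (f + 1) b) _ rfl (by omega) (tbN_even _ _ _ _)
  simp only [FN, CaseN, CN] at hh ⊢
  generalize FT t a A f b B (tbN t a f b) = v at *
  generalize FT t a A (f + 1) b B (tbN t a (f + 1) b) = v' at *
  rcases tbN_spec t a f b with h | h | h | h | h <;>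
  rcases tbN_spec t a (f + 1) b with h' | h' | h' | h' | h' <;>
  first | (exfalso; omega) | skip
  all_goals
    generalize tbN t a f b = T at *
    generalize tbN t a (f + 1) b = T' at *
    obtain ⟨rfl⟩ : T = _ := by first | exact h.2.2.2.2 | exact h.2.2.2 | exact h.2
    obtain ⟨rfl⟩ : T' = _ := by first | exact h'.2.2.2.2 | exact h'.2.2.2 | exact h'.2
    unfold Spec at s1 s2
    rcases abs_cases (v - 4) with ⟨e, he⟩ | ⟨e, he⟩ <;> rw [e] <;>
      rcases s1 with s1 | s1 | s1 <;> rcases s2 with s2 | s2 | s2 <;> omega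
set_option maxHeartbeats 0 in
theorem up_lo (t a A f b B d : ℕ) (hA : a = 0 → A = 0) (hB : b = 0 → B = 0)
    (hne : 1 ≤ t + a + f + b)
    (hh : f = 0 ∧ (CaseN t a A f (b + 1) (B + d) ∨ t = 0) ∧ (d = 0 ∨ b ≤ B)) :
    (2 * (d : ℤ) + 2) + |FN t a A f b B - 4| ≤ FN t a A f (b + 1) (B + d) := by
  have s1 := FT_spec t a A f b B (tbN t a f b) _ rfl hne (tbN_even _ _ _ _)
  have s2 := FT_spec t a A f (b + 1) (B + d) (tbN t a f (b + 1)) _ rfl (by omega) (tbN_even _ _ _ _)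
  simp only [FN, CaseN, CN] at hh ⊢
  generalize FT t a A f b B (tbN t a f b) = v at *
  generalize FT t a A f (b + 1) (B + d) (tbN t a f (b + 1)) = v' at *
  rcases tbN_spec t a f b with h | h | h | h | h <;>
  rcases tbN_spec t a f (b + 1) with h' | h' | h' | h' | h' <;>
  first | (exfalso; omega) | skip
  all_goals
    generalize tbN t a f b = T at *
    generalize tbN t a f (b + 1) = T' at *
    obtain ⟨rfl⟩ : T = _ := by first | exact h.2.2.2.2 | exact h.2.2.2 | exact h.2
    obtain ⟨rfl⟩ : T' = _ := by first | exact h'.2.2.2.2 | exact h'.2.2.2 | exact h'.2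
    unfold Spec at s1 s2
    rcases abs_cases (v - 4) with ⟨e, he⟩ | ⟨e, he⟩ <;> rw [e] <;>
      rcases s1 with s1 | s1 | s1 <;> rcases s2 with s2 | s2 | s2 <;> omega
set_option maxHeartbeats 0 in
theorem up_c3 (t a A f b B d : ℕ) (hA : a = 0 → A = 0) (hB : b = 0 → B = 0)
    (hne : 1 ≤ t + a + f + b)
    (hh : ¬ CaseN (t + 1) a A f b B) :
    1 + |FN t a A f b B - 2| ≤ FN (t + 1) a A f b B := by
  have s1 := FT_spec t a A f b B (tbN t a f b) _ rfl hne (tbN_even _ _ _ _)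
  have s2 := FT_spec (t + 1) a A f b B (tbN (t + 1) a f b) _ rfl (by omega) (tbN_even _ _ _ _)
  simp only [FN, CaseN, CN] at hh ⊢
  generalize FT t a A f b B (tbN t a f b) = v at *
  generalize FT (t + 1) a A f b B (tbN (t + 1) a f b) = v' at *
  rcases tbN_spec t a f b with h | h | h | h | h <;>
  rcases tbN_spec (t + 1) a f b with h' | h' | h' | h' | h' <;>
  first | (exfalso; omega) | skip
  all_goals
    generalize tbN t a f b = T at *
    generalize tbN (t + 1) a f b = T' at *
    obtain ⟨rfl⟩ : T = _ := by first | exact h.2.2.2.2 | exact h.2.2.2 | exact h.2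
    obtain ⟨rfl⟩ : T' = _ := by first | exact h'.2.2.2.2 | exact h'.2.2.2 | exact h'.2
    unfold Spec at s1 s2
    rcases abs_cases (v - 2) with ⟨e, he⟩ | ⟨e, he⟩ <;> rw [e] <;>
      rcases s1 with s1 | s1 | s1 <;> rcases s2 with s2 | s2 | s2 <;> omega
set_option maxHeartbeats 0 in
theorem up_ch (t a A f b B d : ℕ) (hA : a = 0 → A = 0) (hB : b = 0 → B = 0)
    (hne : 1 ≤ t + a + f + b)
    (hh : t = 0 ∧ f = 0 ∧ b = 0) :
    ((d : ℤ) + 2) + |FN t a A f b B - 2| ≤ FN t (a + 1) (A + d) f b B := by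
  have s1 := FT_spec t a A f b B (tbN t a f b) _ rfl hne (tbN_even _ _ _ _)
  have s2 := FT_spec t (a + 1) (A + d) f b B (tbN t (a + 1) f b) _ rfl (by omega) (tbN_even _ _ _ _)
  simp only [FN, CaseN, CN] at hh ⊢
  generalize FT t a A f b B (tbN t a f b) = v at *
  generalize FT t (a + 1) (A + d) f b B (tbN t (a + 1) f b) = v' at *
  rcases tbN_spec t a f b with h | h | h | h | h <;>
  rcases tbN_spec t (a + 1) f b with h' | h' | h' | h' | h' <;>
  first | (exfalso; omega) | skip
  all_goals
    generalize tbN t a f b = T at *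
    generalize tbN t (a + 1) f b = T' at *
    obtain ⟨rfl⟩ : T = _ := by first | exact h.2.2.2.2 | exact h.2.2.2 | exact h.2
    obtain ⟨rfl⟩ : T' = _ := by first | exact h'.2.2.2.2 | exact h'.2.2.2 | exact h'.2
    unfold Spec at s1 s2
    rcases abs_cases (v - 2) with ⟨e, he⟩ | ⟨e, he⟩ <;> rw [e] <;>
      rcases s1 with s1 | s1 | s1 <;> rcases s2 with s2 | s2 | s2 <;> omega

/-- Number of 3-chains contributed by a component. -/
def wt : Component → ℕ
  | .chain n => if n = 3 then 1 else 0
  | .loop _ => 0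
/-- Number of longer chains. -/
def wa : Component → ℕ
  | .chain n => if n = 3 then 0 else 1
  | .loop _ => 0
/-- Excess length of longer chains. -/
def wA : Component → ℕ
  | .chain n => n - 4
  | .loop _ => 0
/-- Number of 4-loops. -/
def wf : Component → ℕ
  | .chain _ => 0
  | .loop n => if n = 4 then 1 else 0
/-- Number of longer loops. -/
def wb : Component → ℕ
  | .chain _ => 0
  | .loop n => if n = 4 then 0 else 1
/-- Half the excess length of longer loops. -/
def wB : Component → ℕ
  | .chain _ => 0
  | .loop n => (n - 6) / 2

/-- Total weight of a position. -/
def tot (w : Component → ℕ) (G : Position) : ℕ := (G.map w).sum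

theorem tot_cons (w : Component → ℕ) (C : Component) (G : Position) :
    tot w (C ::ₘ G) = tot w G + w C := by
  simp [tot, add_comm]

theorem tot_zero (w : Component → ℕ) : tot w 0 = 0 := by simp [tot]

theorem tot_eq_zero (w : Component → ℕ) (G : Position) : tot w G = 0 ↔ ∀ C ∈ G, w C = 0 := by
  simp [tot, Multiset.sum_eq_zero_iff]

theorem Valid.of_cons {C : Component} {G : Position} (h : Position.Valid (C ::ₘ G)) :
    C.Valid ∧ G.Valid :=
  ⟨h C (Multiset.mem_cons_self _ _), fun D hD => h D (Multiset.mem_cons_of_mem hD)⟩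

/-- The conjectural value of a position. -/
def VF (G : Position) : ℤ := FN (tot wt G) (tot wa G) (tot wA G) (tot wf G) (tot wb G) (tot wB G)

/-- The exceptional cases for a position. -/
def CaseP (G : Position) : Prop :=
  CaseN (tot wt G) (tot wa G) (tot wA G) (tot wf G) (tot wb G) (tot wB G)

theorem hA_of (G : Position) (hG : G.Valid) : tot wa G = 0 → tot wA G = 0 := by
  rw [tot_eq_zero, tot_eq_zero]
  intro h C hC
  have := h C hC
  have hv := hG C hC
  cases C with
  | chain n => simp only [wa, wA, Component.Valid] at *; split_ifs at this; omega
  | loop n => rfl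

theorem hB_of (G : Position) (hG : G.Valid) : tot wb G = 0 → tot wB G = 0 := by
  rw [tot_eq_zero, tot_eq_zero]
  intro h C hC
  have := h C hC
  have hv := hG C hC
  cases C with
  | loop n => simp only [wb, wB, Component.Valid] at *; split_ifs at this; omega
  | chain n => rfl

theorem eq_zero_of_tot (G : Position)
    (h : tot wt G + tot wa G + tot wf G + tot wb G = 0) : G = 0 := by
  induction G using Multiset.induction_on with
  | empty => rfl
  | cons C G _ =>
    exfalso
    simp only [tot_cons] at h
    cases C with
    | chain n => simp only [wt, wa] at h; split_ifs at h <;> omega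
    | loop n => simp only [wf, wb] at h; split_ifs at h <;> omega

/-- A case split on valid components. -/
theorem comp_cases (C : Component) (h : C.Valid) :
    C = .chain 3 ∨ (∃ d, C = .chain (d + 4)) ∨ C = .loop 4 ∨ (∃ d, C = .loop (2 * d + 6)) := by
  cases C with
  | chain n =>
    simp only [Component.Valid] at h
    rcases Nat.lt_or_ge n 4 with h' | h'
    · left; congr; omega
    · right; left; exact ⟨n - 4, by congr; omega⟩
  | loop n =>
    obtain ⟨h, k, hk⟩ := h
    rcases Nat.lt_or_ge n 6 with h' | h'
    · right; right; left; congr; omega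
    · right; right; right; exact ⟨k - 3, by congr; omega⟩

theorem VF_c3 (G : Position) : VF (.chain 3 ::ₘ G) =
    FN (tot wt G + 1) (tot wa G) (tot wA G) (tot wf G) (tot wb G) (tot wB G) := by
  simp [VF, tot_cons, wt, wa, wA, wf, wb, wB]

theorem VF_ch (G : Position) (d : ℕ) : VF (.chain (d + 4) ::ₘ G) =
    FN (tot wt G) (tot wa G + 1) (tot wA G + d) (tot wf G) (tot wb G) (tot wB G) := by
  simp [VF, tot_cons, wt, wa, wA, wf, wb, wB]

theorem VF_l4 (G : Position) : VF (.loop 4 ::ₘ G) =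
    FN (tot wt G) (tot wa G) (tot wA G) (tot wf G + 1) (tot wb G) (tot wB G) := by
  simp [VF, tot_cons, wt, wa, wA, wf, wb, wB]

theorem VF_lo (G : Position) (d : ℕ) : VF (.loop (2 * d + 6) ::ₘ G) =
    FN (tot wt G) (tot wa G) (tot wA G) (tot wf G) (tot wb G + 1) (tot wB G + d) := by
  simp [VF, tot_cons, wt, wa, wA, wf, wb, wB]

theorem CaseP_c3 (G : Position) : CaseP (.chain 3 ::ₘ G) =
    CaseN (tot wt G + 1) (tot wa G) (tot wA G) (tot wf G) (tot wb G) (tot wB G) := by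
  simp [CaseP, tot_cons, wt, wa, wA, wf, wb, wB]

theorem CaseP_l4 (G : Position) : CaseP (.loop 4 ::ₘ G) =
    CaseN (tot wt G) (tot wa G) (tot wA G) (tot wf G + 1) (tot wb G) (tot wB G) := by
  simp [CaseP, tot_cons, wt, wa, wA, wf, wb, wB]

theorem CaseP_lo (G : Position) (d : ℕ) : CaseP (.loop (2 * d + 6) ::ₘ G) =
    CaseN (tot wt G) (tot wa G) (tot wA G) (tot wf G) (tot wb G + 1) (tot wB G + d) := by
  simp [CaseP, tot_cons, wt, wa, wA, wf, wb, wB]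

theorem VF_zero : VF 0 = 0 := by
  simp [VF, tot_zero, FN, FT]

theorem VF_single (C : Component) (hC : C.Valid) : VF {C} = openVal C 0 := by
  rw [← Multiset.cons_zero]
  rcases comp_cases C hC with rfl | ⟨d, rfl⟩ | rfl | ⟨d, rfl⟩
  · rw [VF_c3]; simp [tot_zero, FN, FT, tbN, openVal]
  · rw [VF_ch]; simp only [tot_zero, FN, FT, tbN, openVal]
    rw [abs_of_nonpos (by norm_num)]
    push_cast
    norm_num
    split_ifs <;> omega
  · rw [VF_l4]; simp [tot_zero, FN, FT, tbN, openVal]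
  · rw [VF_lo]; simp only [tot_zero, FN, FT, tbN, openVal]
    rw [abs_of_nonpos (by norm_num)]
    push_cast
    norm_num
    split_ifs <;> omega

theorem low (C : Component) (G : Position) (h : Position.Valid (C ::ₘ G)) :
    VF (C ::ₘ G) ≤ openVal C (VF G) := by
  obtain ⟨hC, hG⟩ := Valid.of_cons h
  by_cases h0 : G = 0
  · subst h0; rw [VF_zero, ← VF_single C hC]; rfl
  have hne : 1 ≤ tot wt G + tot wa G + tot wf G + tot wb G := by
    by_contra hh; exact h0 (eq_zero_of_tot G (by omega))
  have hA := hA_of G hG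
  have hB := hB_of G hG
  rcases comp_cases C hC with rfl | ⟨d, rfl⟩ | rfl | ⟨d, rfl⟩
  · rw [VF_c3]; exact low_c3 _ _ _ _ _ _ 0 hA hB hne
  · rw [VF_ch]; convert low_ch _ _ _ _ _ _ d hA hB hne using 1
    simp only [openVal, VF]; push_cast; ring
  · rw [VF_l4]; convert low_l4 _ _ _ _ _ _ 0 hA hB hne using 1
    simp only [openVal, VF]; push_cast; ring
  · rw [VF_lo]; convert low_lo _ _ _ _ _ _ d hA hB hne using 1
    simp only [openVal, VF]; push_cast; ring

theorem tot_wb_le (G : Position) (hG : G.Valid) (h : ∀ m, Component.loop m ∈ G → 8 ≤ m) :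
    tot wb G ≤ tot wB G := by
  unfold tot
  apply Multiset.sum_map_le_sum_map
  intro C hC
  cases C with
  | chain n => simp [wb]
  | loop n =>
    have := h n hC
    simp only [wb, wB]; split_ifs <;> omega

theorem tot_wf_zero (G : Position) (h : Component.loop 4 ∉ G) : tot wf G = 0 := by
  rw [tot_eq_zero]
  intro C hC
  cases C with
  | chain n => rfl
  | loop n =>
    simp only [wf]; split_ifs with h4
    · subst h4; exact absurd hC h
    · rfl

/-- The recommended moves. -/
def Rec (G : Position) (C : Component) : Prop :=
  ((CaseP G ∨ tot wt G = 0) ∧ ∃ n, C = .loop n ∧ ∀ m : ℕ, Component.loop m ∈ G → n ≤ m) ∨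
  (¬ CaseP G ∧ C = .chain 3) ∨
  (tot wt G = 0 ∧ tot wf G = 0 ∧ tot wb G = 0)

theorem up (C : Component) (G : Position) (h : Position.Valid (C ::ₘ G)) (hr : Rec (C ::ₘ G) C) :
    openVal C (VF G) ≤ VF (C ::ₘ G) := by
  obtain ⟨hC, hG⟩ := Valid.of_cons h
  by_cases h0 : G = 0
  · subst h0; rw [VF_zero, ← VF_single C hC]; rfl
  have hne : 1 ≤ tot wt G + tot wa G + tot wf G + tot wb G := by
    by_contra hh; exact h0 (eq_zero_of_tot G (by omega))
  have hA := hA_of G hG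
  have hB := hB_of G hG
  rcases comp_cases C hC with rfl | ⟨d, rfl⟩ | rfl | ⟨d, rfl⟩
  · rcases hr with ⟨_, n, hn, _⟩ | ⟨hr, _⟩ | hr
    · cases hn
    · rw [VF_c3]; rw [CaseP_c3] at hr; exact up_c3 _ _ _ _ _ _ 0 hA hB hne hr
    · exfalso; simp [tot_cons, wt] at hr
  · rcases hr with ⟨_, n, hn, _⟩ | ⟨hr, hn⟩ | hr
    · cases hn
    · exfalso; injection hn; omega
    · rw [VF_ch]
      simp [tot_cons, wt, wf, wb] at hr
      convert up_ch _ _ _ _ _ _ d hA hB hne hr using 1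
      simp only [openVal, VF]; push_cast; ring
  · rcases hr with ⟨hr, _⟩ | ⟨hr, hn⟩ | hr
    · rw [VF_l4]
      rw [CaseP_l4] at hr
      simp only [tot_cons, wt, add_zero] at hr
      convert up_l4 _ _ _ _ _ _ 0 hA hB hne hr using 1
      simp only [openVal, VF]; push_cast; ring
    · cases hn
    · exfalso; simp [tot_cons, wf] at hr
  · rcases hr with ⟨hr, n, hn, hm⟩ | ⟨hr, hn⟩ | hr
    · rw [VF_lo]
      rw [CaseP_lo] at hr
      simp only [tot_cons, wt, add_zero] at hr
      injection hn with hn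
      subst hn
      have h4 : tot wf G = 0 := tot_wf_zero G fun h4 => by
        have := hm 4 (Multiset.mem_cons_of_mem h4); omega
      have h8 : d = 0 ∨ tot wb G ≤ tot wB G := by
        by_cases hd : d = 0
        · exact Or.inl hd
        · refine Or.inr (tot_wb_le G hG fun m hmG => ?_)
          have := hm m (Multiset.mem_cons_of_mem hmG); omega
      convert up_lo _ _ _ _ _ _ d hA hB hne ⟨h4, hr, h8⟩ using 1
      simp only [openVal, VF]; push_cast; ring
    · cases hn
    · exfalso
      have := hr.2.2
      simp only [tot_cons, wb] at this
      split_ifs at this <;> omega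

theorem theta_eq (G : Position) : theta G = tot wt G := by
  unfold theta
  induction G using Multiset.induction_on with
  | empty => rfl
  | cons C G ih =>
    rw [tot_cons, Multiset.count_cons, ih]
    cases C with
    | chain n => simp [wt, eq_comm]
    | loop n => simp [wt]

theorem numF_eq (G : Position) : G.count (.loop 4) = tot wf G := by
  induction G using Multiset.induction_on with
  | empty => rfl
  | cons C G ih =>
    rw [tot_cons, Multiset.count_cons, ih]
    cases C with
    | loop n => simp [wf, eq_comm]
    | chain n => simp [wf]

theorem mem_c3 (G : Position) : Component.chain 3 ∈ G ↔ 1 ≤ tot wt G := by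
  rw [← theta_eq, theta, Multiset.one_le_count_iff_mem]

theorem mem_l4 (G : Position) : Component.loop 4 ∈ G ↔ 1 ≤ tot wf G := by
  rw [← numF_eq, Multiset.one_le_count_iff_mem]

theorem noloop_iff (G : Position) :
    (∀ C ∈ G, C.isLoop = false) ↔ tot wf G = 0 ∧ tot wb G = 0 := by
  rw [tot_eq_zero, tot_eq_zero]
  constructor
  · intro h
    constructor <;> intro C hC <;> have := h C hC <;> cases C <;>
      simp_all [Component.isLoop, wf, wb]
  · rintro ⟨h1, h2⟩ C hC
    have h1 := h1 C hC
    have h2 := h2 C hC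
    cases C with
    | chain n => rfl
    | loop n => simp only [wf, wb] at h1 h2; split_ifs at h1 h2

theorem allloop_iff (G : Position) :
    (∀ C ∈ G, C.isLoop = true) ↔ tot wt G = 0 ∧ tot wa G = 0 := by
  rw [tot_eq_zero, tot_eq_zero]
  constructor
  · intro h
    constructor <;> intro C hC <;> have := h C hC <;> cases C <;>
      simp_all [Component.isLoop, wt, wa]
  · rintro ⟨h1, h2⟩ C hC
    have h1 := h1 C hC
    have h2 := h2 C hC
    cases C with
    | loop n => rfl
    | chain n => simp only [wt, wa] at h1 h2; split_ifs at h1 h2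

theorem exists_loop_iff (G : Position) :
    (∃ C ∈ G, C.isLoop = true) ↔ ¬ (tot wf G = 0 ∧ tot wb G = 0) := by
  rw [← noloop_iff]; push Not; simp

theorem only3_iff (G : Position) :
    (∀ C ∈ G, C.isChain = true → C = Component.chain 3) ↔ tot wa G = 0 := by
  rw [tot_eq_zero]
  refine forall₂_congr fun C _ => ?_
  cases C <;> simp [wa, Component.isChain]

theorem zero_iff (G : Position) :
    G = 0 ↔ (tot wt G = 0 ∧ tot wa G = 0) ∧ (tot wf G = 0 ∧ tot wb G = 0) := by
  constructor
  · rintro rfl; simp [tot_zero]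
  · intro h; exact eq_zero_of_tot G (by omega)

theorem tb_eq (G : Position) :
    tb G = tbN (tot wt G) (tot wa G) (tot wf G) (tot wb G) := by
  have h0 := zero_iff G
  have h1 := allloop_iff G
  have h2 := exists_loop_iff G
  have h3 := only3_iff G
  have h4 := mem_c3 G
  unfold tb tbN
  simp only [h0, h1, h2, h3, h4]
  split_ifs <;> first | rfl | (exfalso; omega)

theorem size_eq (G : Position) (hG : G.Valid) : size G =
    3 * tot wt G + 4 * tot wa G + tot wA G + 4 * tot wf G + 6 * tot wb G + 2 * tot wB G := by
  induction G using Multiset.induction_on with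
  | empty => simp [size, tot_zero]
  | cons C G ih =>
    obtain ⟨hC, hG⟩ := Valid.of_cons hG
    have ih := ih hG
    have : size (C ::ₘ G) = C.size + size G := by simp [size]
    rw [this, ih]
    simp only [tot_cons]
    rcases comp_cases C hC with rfl | ⟨d, rfl⟩ | rfl | ⟨d, rfl⟩ <;>
      simp [Component.size, wt, wa, wA, wf, wb, wB] <;> omega

theorem numChains_eq (G : Position) : numChains G = tot wt G + tot wa G := by
  unfold numChains
  induction G using Multiset.induction_on with
  | empty => simp [tot_zero]
  | cons C G ih =>
    simp only [tot_cons]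
    cases C with
    | chain n =>
      rw [Multiset.filter_cons_of_pos _ (by rfl), Multiset.card_cons, ih]
      simp only [wt, wa]; split_ifs <;> omega
    | loop n =>
      rw [Multiset.filter_cons_of_neg _ (by simp [Component.isChain]), ih]
      simp [wt, wa]

theorem numLoops_eq (G : Position) : numLoops G = tot wf G + tot wb G := by
  unfold numLoops
  induction G using Multiset.induction_on with
  | empty => simp [tot_zero]
  | cons C G ih =>
    simp only [tot_cons]
    cases C with
    | loop n =>
      rw [Multiset.filter_cons_of_pos _ (by rfl), Multiset.card_cons, ih]
      simp only [wf, wb]; split_ifs <;> omega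
    | chain n =>
      rw [Multiset.filter_cons_of_neg _ (by simp [Component.isLoop]), ih]
      simp [wf, wb]

theorem cval_eq (G : Position) (hG : G.Valid) : cval G =
    CN (tot wt G) (tot wa G) (tot wA G) (tot wf G) (tot wb G) (tot wB G) := by
  unfold cval CN
  rw [size_eq G hG, numChains_eq, numLoops_eq, tb_eq]
  push_cast; ring

theorem tots_c3 (G : Position) : tot wt (.chain 3 ::ₘ G) = tot wt G + 1 ∧
    tot wa (.chain 3 ::ₘ G) = tot wa G ∧ tot wA (.chain 3 ::ₘ G) = tot wA G ∧
    tot wf (.chain 3 ::ₘ G) = tot wf G ∧ tot wb (.chain 3 ::ₘ G) = tot wb G ∧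
    tot wB (.chain 3 ::ₘ G) = tot wB G := by
  simp [tot_cons, wt, wa, wA, wf, wb, wB]

theorem tots_l4 (G : Position) : tot wt (.loop 4 ::ₘ G) = tot wt G ∧
    tot wa (.loop 4 ::ₘ G) = tot wa G ∧ tot wA (.loop 4 ::ₘ G) = tot wA G ∧
    tot wf (.loop 4 ::ₘ G) = tot wf G + 1 ∧ tot wb (.loop 4 ::ₘ G) = tot wb G ∧
    tot wB (.loop 4 ::ₘ G) = tot wB G := by
  simp [tot_cons, wt, wa, wA, wf, wb, wB]

theorem case1_iff (G : Position) : OpenerCase1 G ↔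
    2 ≤ cval G ∧ tot wt G = 1 ∧ tot wa G = 0 ∧ 1 ≤ tot wf G + tot wb G := by
  unfold OpenerCase1
  refine and_congr_right fun _ => ?_
  constructor
  · rintro ⟨L, hL, hl, rfl⟩
    rw [allloop_iff] at hl
    rw [Ne, zero_iff] at hL
    have := tots_c3 L
    omega
  · intro h
    obtain ⟨L, rfl⟩ := Multiset.exists_cons_of_mem ((mem_c3 G).2 (by omega))
    have := tots_c3 L
    refine ⟨L, ?_, ?_, rfl⟩
    · rw [Ne, zero_iff]; omega
    · rw [allloop_iff]; omega

theorem special_iff (G : Position) :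
    G = Component.loop 4 ::ₘ Component.chain 3 ::ₘ Component.chain 3 ::ₘ {Component.chain 3} ↔
    (tot wf G = 1 ∧ tot wt G = 3 ∧ tot wa G = 0 ∧ tot wb G = 0) := by
  rw [← Multiset.cons_zero]
  constructor
  · rintro rfl
    simp only [tot_cons, tot_zero, wt, wa, wf, wb]
    simp
  · intro h
    obtain ⟨G1, rfl⟩ := Multiset.exists_cons_of_mem ((mem_l4 G).2 (by omega))
    have h1 := tots_l4 G1
    obtain ⟨G2, rfl⟩ := Multiset.exists_cons_of_mem ((mem_c3 G1).2 (by omega))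
    have h2 := tots_c3 G2
    obtain ⟨G3, rfl⟩ := Multiset.exists_cons_of_mem ((mem_c3 G2).2 (by omega))
    have h3 := tots_c3 G3
    obtain ⟨G4, rfl⟩ := Multiset.exists_cons_of_mem ((mem_c3 G3).2 (by omega))
    have h4 := tots_c3 G4
    obtain rfl : G4 = 0 := eq_zero_of_tot G4 (by omega)
    rfl

theorem case3_iff (G : Position) (hG : G.Valid) : OpenerCase3 G ↔
    cval G ≤ -2 ∧ 1 ≤ tot wf G ∧ tot wt G = 1 ∧
      (tot wA G + 2 * tot wb G + 2 * tot wB G) % 4 = 0 := by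
  unfold OpenerCase3
  refine and_congr_right fun _ => ?_
  constructor
  · rintro ⟨H, rfl, hl, h4⟩
    rw [size_eq H (Valid.of_cons (Valid.of_cons hG).2).2] at h4
    rw [theta_eq] at hl
    have := tots_l4 (.chain 3 ::ₘ H)
    have := tots_c3 H
    omega
  · intro h
    obtain ⟨G1, rfl⟩ := Multiset.exists_cons_of_mem ((mem_l4 G).2 (by omega))
    have h1 := tots_l4 G1
    obtain ⟨H, rfl⟩ := Multiset.exists_cons_of_mem ((mem_c3 G1).2 (by omega))
    have h2 := tots_c3 H
    refine ⟨H, rfl, ?_, ?_⟩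
    · rw [theta_eq]; omega
    · rw [size_eq H (Valid.of_cons (Valid.of_cons hG).2).2]; omega

theorem case_iff (G : Position) (hG : G.Valid) :
    (OpenerCase1 G ∨ OpenerCase2 G ∨ OpenerCase3 G) ↔ CaseP G := by
  rw [case1_iff, case3_iff G hG]
  unfold OpenerCase2 CaseP CaseN
  rw [Ne, special_iff, mem_l4, cval_eq G hG]
  omega

theorem standard_rec (G : Position) (hc : ¬ CaseP G) (C : Component) (h : IsStandardMove G C) :
    C ∈ G ∧ Rec G C := by
  rcases h with ⟨rfl, h⟩ | ⟨ht, n, rfl, h, hm⟩ | ⟨ht, hl, n, rfl, h, hm⟩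
  · exact ⟨h, Or.inr (Or.inl ⟨hc, rfl⟩)⟩
  · rw [theta_eq] at ht
    exact ⟨h, Or.inl ⟨Or.inr ht, n, rfl, hm⟩⟩
  · rw [theta_eq] at ht
    rw [noloop_iff] at hl
    exact ⟨h, Or.inr (Or.inr ⟨ht, hl⟩)⟩

theorem exists_min_loop (G : Position) (h : ∃ n, Component.loop n ∈ G) :
    ∃ n, Component.loop n ∈ G ∧ ∀ m : ℕ, Component.loop m ∈ G → n ≤ m := by
  classical
  exact ⟨Nat.find h, Nat.find_spec h, fun m hm => Nat.find_min' h hm⟩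

theorem exists_rec (G : Position) (hne : G ≠ 0) : ∃ C ∈ G, Rec G C := by
  by_cases hl : ∃ n, Component.loop n ∈ G
  · obtain ⟨n, hn, hm⟩ := exists_min_loop G hl
    by_cases hc : CaseP G ∨ tot wt G = 0
    · exact ⟨_, hn, Or.inl ⟨hc, n, rfl, hm⟩⟩
    · push Not at hc
      exact ⟨.chain 3, (mem_c3 G).2 (by omega), Or.inr (Or.inl ⟨hc.1, rfl⟩)⟩
  · have hl : ∀ C ∈ G, C.isLoop = false := by
      intro C hC
      cases C with
      | chain n => rfl
      | loop n => exact absurd ⟨n, hC⟩ hl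
    rw [noloop_iff] at hl
    by_cases ht : tot wt G = 0
    · obtain ⟨C, hC⟩ := Multiset.exists_mem_of_ne_zero hne
      exact ⟨C, hC, Or.inr (Or.inr ⟨ht, hl⟩)⟩
    · refine ⟨.chain 3, (mem_c3 G).2 (by omega), Or.inr (Or.inl ⟨?_, rfl⟩)⟩
      unfold CaseP CaseN
      omega

theorem value_rec (G : Position) (hne : G ≠ 0) :
    value G = sInf { x : ℤ | ∃ C ∈ G, x = openVal C (value (G.erase C)) } := by
  obtain ⟨k, hk⟩ : ∃ k, Multiset.card G = k + 1 :=
    Nat.exists_eq_succ_of_ne_zero (by simpa using hne)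
  have : value G = valueAux (k + 1) G := by rw [value, hk]
  rw [this, valueAux, if_neg hne]
  congr 1
  ext x
  refine exists_congr fun C => and_congr_right fun hC => ?_
  rw [value, Multiset.card_erase_of_mem hC, hk]
  rfl

theorem value_eq (k : ℕ) : ∀ G : Position, Multiset.card G = k → G.Valid → value G = VF G := by
  induction k with
  | zero =>
    intro G hk _
    obtain rfl : G = 0 := by simpa using hk
    rw [VF_zero]; rfl
  | succ k ih =>
    intro G hk hG
    have hne : G ≠ 0 := by rintro rfl; simp at hk
    have he : ∀ C ∈ G, value (G.erase C) = VF (G.erase C) := by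
      intro C hC
      apply ih
      · rw [Multiset.card_erase_of_mem hC, hk]; rfl
      · exact fun D hD => hG D (Multiset.mem_of_mem_erase hD)
    rw [value_rec G hne]
    apply IsLeast.csInf_eq
    constructor
    · obtain ⟨C, hC, hr⟩ := exists_rec G hne
      refine ⟨C, hC, ?_⟩
      rw [he C hC]
      have hcons := Multiset.cons_erase hC
      have h1 := low C (G.erase C) (by rwa [hcons])
      have h2 := up C (G.erase C) (by rwa [hcons]) (by rwa [hcons])
      rw [hcons] at h1 h2
      exact le_antisymm h1 h2
    · rintro x ⟨C, hC, rfl⟩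
      rw [he C hC]
      have hcons := Multiset.cons_erase hC
      have h1 := low C (G.erase C) (by rwa [hcons])
      rwa [hcons] at h1

theorem optimal_of_rec (G : Position) (hG : G.Valid) (C : Component) (hC : C ∈ G)
    (hr : Rec G C) : Optimal G C := by
  refine ⟨hC, ?_⟩
  rw [valueOpen, value_eq _ G rfl hG,
    value_eq _ (G.erase C) rfl fun D hD => hG D (Multiset.mem_of_mem_erase hD)]
  have hcons := Multiset.cons_erase hC
  have h1 := low C (G.erase C) (by rwa [hcons])
  have h2 := up C (G.erase C) (by rwa [hcons]) (by rwa [hcons])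
  rw [hcons] at h1 h2
  exact le_antisymm h2 h1

/-- Opener strategy: in cases (1)-(3) opening a loop of minimal length is optimal;
in all other cases the standard move is optimal. -/
theorem opener_strategy (G : Position) (hG : G.Valid) (hne : G ≠ 0) :
    ((OpenerCase1 G ∨ OpenerCase2 G ∨ OpenerCase3 G) →
      ∀ n : ℕ, Component.loop n ∈ G → (∀ m : ℕ, Component.loop m ∈ G → n ≤ m) →
        Optimal G (Component.loop n)) ∧
    (¬ (OpenerCase1 G ∨ OpenerCase2 G ∨ OpenerCase3 G) →
      ∀ C : Component, IsStandardMove G C → Optimal G C) := by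
  rw [case_iff G hG]
  constructor
  · intro hc n hn hm
    exact optimal_of_rec G hG _ hn (Or.inl ⟨Or.inl hc, n, rfl, hm⟩)
  · intro hc C hC
    obtain ⟨h, hr⟩ := standard_rec G hc C hC
    exact optimal_of_rec G hG _ h hr

end DotsAndBoxes
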